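/- arXiv:2205.08140 — 6 statements merged into one kernel-verified Lean document; each statement's English description precedes it below -/
import Mathlib

section
/- Let L>0, λ>0 and l ≥ 0. Let ŝ, i : [0,L]→ℝ be absolutely continuous functions with ŝ(0)=i(0)=0, -1 ≤ ŝ(a) ≤ 0 and 0 ≤ i(a) ≤ 1 for all a∈[0,L]. Then ∫₀^L |(λ+l)ŝ(a)+ŝ'(a)| da + ∫₀^L |(λ+l)i(a)+i'(a)| da ≥ λ(∫₀^L |ŝ(a)| da + ∫₀^L |i(a)| da). -/
open MeasureTheory Set

lemma aux_nonneg (L lam l : ℝ) (hL : 0 < L) (hl : 0 ≤ l)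
    (u du : ℝ → ℝ) (hInt : IntervalIntegrable du volume 0 L)
    (hAC : ∀ a ∈ Icc (0:ℝ) L, u a = ∫ x in (0:ℝ)..a, du x)
    (hb : ∀ a ∈ Icc (0:ℝ) L, 0 ≤ u a) :
    lam * (∫ a in (0:ℝ)..L, |u a|) ≤ ∫ a in (0:ℝ)..L, |(lam + l) * u a + du a| := by
  have hc : ContinuousOn u (uIcc 0 L) := by
    have h := (hInt.absolutelyContinuousOnInterval_intervalIntegral
      (left_mem_uIcc)).continuousOn
    refine h.congr fun a ha => ?_
    rw [uIcc_of_le hL.le] at ha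
    exact hAC a ha
  have hu : IntervalIntegrable u volume 0 L := hc.intervalIntegrable
  have habs : (∫ a in (0:ℝ)..L, |u a|) = ∫ a in (0:ℝ)..L, u a := by
    apply intervalIntegral.integral_congr
    intro a ha
    rw [uIcc_of_le hL.le] at ha
    exact abs_of_nonneg (hb a ha)
  have hsum : IntervalIntegrable (fun a => (lam + l) * u a + du a) volume 0 L :=
    (hu.const_mul _).add hInt
  have h1 : (∫ a in (0:ℝ)..L, ((lam + l) * u a + du a)) ≤
      ∫ a in (0:ℝ)..L, |(lam + l) * u a + du a| :=
    intervalIntegral.integral_mono_on hL.le hsum hsum.abs fun a _ => le_abs_self _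
  rw [intervalIntegral.integral_add (hu.const_mul _) hInt,
    intervalIntegral.integral_const_mul, ← hAC L (right_mem_Icc.2 hL.le)] at h1
  have h2 := hb L (right_mem_Icc.2 hL.le)
  have h3 : 0 ≤ ∫ a in (0:ℝ)..L, u a := intervalIntegral.integral_nonneg hL.le hb
  rw [habs]
  nlinarith [mul_nonneg hl h3]

/-- Quasi-dissipativity estimate for the transport operator `A = -(d/da)I₂` on
`L¹(0,L) × L¹(0,L)`: for absolutely continuous `ŝ, i` vanishing at `0` with
`-1 ≤ ŝ ≤ 0` and `0 ≤ i ≤ 1`,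
`‖(λ + l)x + x'‖_X ≥ λ ‖x‖_X`. -/
theorem stmt_3
    (L lam l : ℝ) (hL : 0 < L) (hlam : 0 < lam) (hl : 0 ≤ l)
    (sh ih dsh dih : ℝ → ℝ)
    (hdsInt : IntervalIntegrable dsh volume 0 L)
    (hdiInt : IntervalIntegrable dih volume 0 L)
    (hsAC : ∀ a ∈ Icc (0:ℝ) L, sh a = ∫ x in (0:ℝ)..a, dsh x)
    (hiAC : ∀ a ∈ Icc (0:ℝ) L, ih a = ∫ x in (0:ℝ)..a, dih x)
    (hsb : ∀ a ∈ Icc (0:ℝ) L, -1 ≤ sh a ∧ sh a ≤ 0)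
    (hib : ∀ a ∈ Icc (0:ℝ) L, 0 ≤ ih a ∧ ih a ≤ 1) :
    lam * ((∫ a in (0:ℝ)..L, |sh a|) + ∫ a in (0:ℝ)..L, |ih a|) ≤
      (∫ a in (0:ℝ)..L, |(lam + l) * sh a + dsh a|) +
        ∫ a in (0:ℝ)..L, |(lam + l) * ih a + dih a| := by
  have h1 := aux_nonneg L lam l hL hl ih dih hdiInt hiAC fun a ha => (hib a ha).1
  have h2 := aux_nonneg L lam l hL hl (fun a => - sh a) (fun a => - dsh a) hdsInt.neg
    (fun a ha => by rw [intervalIntegral.integral_neg, hsAC a ha])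
    fun a ha => neg_nonneg.2 (hsb a ha).2
  have h3 : ∀ a, |(lam + l) * - sh a + - dsh a| = |(lam + l) * sh a + dsh a| := fun a => by
    rw [← abs_neg]; congr 1; ring
  simp only [abs_neg, h3] at h2
  linarith
end

section
/- Let n ≥ 1, and let Tₖ, γₖ, βₖ, Nₖ (k=1,…,n) be real constants with βₖ ≠ 0, and α₁ᵏ, α₂ᵏ real gains. For x = (i₁,…,iₙ,s₁,…,sₙ) set fₖ(x) = Tₖ i_{k-1} - (Tₖ+γₖ) iₖ + βₖ sₖ Σ_{j=1}^n Nⱼ iⱼ (with the conventions i₀ = 0 and f₀(x) = 0). Let (i₁(t),…,iₙ(t),s₁(t),…,sₙ(t)) be a differentiable solution on an interval J of the closed-loop system diₖ/dt = fₖ(x(t)), dsₖ/dt = (1/(βₖ Σ_{j=1}^n Nⱼ iⱼ(t)))·( fₖ(x(t))(Tₖ+γₖ-α₂ᵏ) - α₁ᵏ iₖ(t) - Tₖ f_{k-1}(x(t)) - βₖ sₖ(t) Σ_{j=1}^n Nⱼ fⱼ(x(t)) ), where Σ_{j=1}^n Nⱼ iⱼ(t) ≠ 0 on J. Then each iₖ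 is twice differentiable on J and satisfies the linear equation d²iₖ/dt² + α₂ᵏ diₖ/dt + α₁ᵏ iₖ = 0. -/
open Finset

/-- Feedback linearization of the age-discretized normalized SIR model (NODE):
along any solution of the closed-loop system obtained from the Isidori-type
linearizing state feedback, each infected proportion `iₖ` is twice differentiable
and satisfies the decoupled linear dynamics `ïₖ + α₂ᵏ i̇ₖ + α₁ᵏ iₖ = 0`. -/
theorem stmt_8
    (n : ℕ) (hn : 1 ≤ n)
    (T γ β N α₁ α₂ : ℕ → ℝ)
    (hβ : ∀ k ∈ Finset.Icc 1 n, β k ≠ 0)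
    (J : Set ℝ) (hJ : IsOpen J)
    (iv sv : ℝ → ℕ → ℝ)
    (hi0 : ∀ t : ℝ, iv t 0 = 0)
    (f : ℝ → ℕ → ℝ)
    (hf0 : ∀ t : ℝ, f t 0 = 0)
    (hf : ∀ t : ℝ, ∀ k ∈ Finset.Icc 1 n,
      f t k = T k * iv t (k - 1) - (T k + γ k) * iv t k +
        β k * sv t k * ∑ j ∈ Finset.Icc 1 n, N j * iv t j)
    (hS : ∀ t ∈ J, (∑ j ∈ Finset.Icc 1 n, N j * iv t j) ≠ 0)
    (hdi : ∀ t ∈ J, ∀ k ∈ Finset.Icc 1 n,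
      HasDerivAt (fun τ => iv τ k) (f t k) t)
    (hds : ∀ t ∈ J, ∀ k ∈ Finset.Icc 1 n,
      HasDerivAt (fun τ => sv τ k)
        ((1 / (β k * ∑ j ∈ Finset.Icc 1 n, N j * iv t j)) *
          (f t k * (T k + γ k - α₂ k) - α₁ k * iv t k - T k * f t (k - 1) -
            β k * sv t k * ∑ j ∈ Finset.Icc 1 n, N j * f t j)) t) :
    ∀ t ∈ J, ∀ k ∈ Finset.Icc 1 n,
      ∃ d2 : ℝ,
        HasDerivAt (fun τ => deriv (fun σ => iv σ k) τ) d2 t ∧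
        d2 + α₂ k * deriv (fun σ => iv σ k) t + α₁ k * iv t k = 0 := by
  intro t ht k hk
  have hd : ∀ τ ∈ J, deriv (fun σ => iv σ k) τ = f τ k := fun τ hτ => (hdi τ hτ k hk).deriv
  have hev : (fun τ => deriv (fun σ => iv σ k) τ) =ᶠ[nhds t] (fun τ =>
      T k * iv τ (k - 1) - (T k + γ k) * iv τ k +
        β k * sv τ k * ∑ j ∈ Finset.Icc 1 n, N j * iv τ j) := by
    filter_upwards [hJ.mem_nhds ht] with τ hτ
    rw [hd τ hτ, hf τ k hk]
  have hprev : HasDerivAt (fun τ => iv τ (k - 1)) (f t (k - 1)) t := by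
    rcases Nat.eq_zero_or_pos (k - 1) with h | h
    · rw [h, hf0]
      have : (fun τ => iv τ 0) = fun _ => (0 : ℝ) := funext hi0
      rw [this]
      exact hasDerivAt_const t 0
    · apply hdi t ht
      rw [Finset.mem_Icc] at hk ⊢
      omega
  have hsum : HasDerivAt (fun τ => ∑ j ∈ Finset.Icc 1 n, N j * iv τ j)
      (∑ j ∈ Finset.Icc 1 n, N j * f t j) t :=
    HasDerivAt.fun_sum fun j hj => (hdi t ht j hj).const_mul (N j)
  have hmain := ((hprev.const_mul (T k)).fun_sub ((hdi t ht k hk).const_mul (T k + γ k))).fun_add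
    (((hds t ht k hk).const_mul (β k)).fun_mul hsum)
  refine ⟨_, hmain.congr_of_eventuallyEq hev, ?_⟩
  rw [hd t ht]
  have hb := hβ k hk
  have hs := hS t ht
  generalize (∑ j ∈ Finset.Icc 1 n, N j * iv t j) = S at *
  generalize (∑ j ∈ Finset.Icc 1 n, N j * f t j) = S' at *
  field_simp
  ring
end

section
/- Let n ≥ 1, let Tₖ, γₖ, βₖ, Nₖ (k=1,…,n) be real constants with βₖ ≠ 0, and let the gains satisfy α₁ᵏ > 0 and α₂ᵏ > 0 for all k (equivalently, both roots of s² + α₂ᵏ s + α₁ᵏ lie in the open left half-plane). Let (i₁(t),…,iₙ(t),s₁(t),…,sₙ(t)) be a differentiable solution on [0,∞) of the closed-loop system diₖ/dt = fₖ(x(t)), dsₖ/dt = (1/(βₖ Σⱼ Nⱼ iⱼ(t)))·( fₖ(x(t))(Tₖ+γₖ-α₂ᵏ) - α₁ᵏ iₖ(t) - Tₖ f_{k-1}(x(t)) - βₖ sₖ(t) Σⱼ Nⱼ fⱼ(x(t)) ), where fₖ(x) = Tₖ i_{k-1} - (Tₖ+γₖ) iₖ + βₖ sₖ Σⱼ Nⱼ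 iⱼ (conventions i₀ = 0, f₀ = 0) and Σⱼ Nⱼ iⱼ(t) ≠ 0 for all t ≥ 0. Then the infected proportions converge exponentially to zero: there exist M > 0 and ω > 0 such that |iₖ(t)| ≤ M e^{-ωt} for all k = 1,…,n and all t ≥ 0. -/
open Finset

theorem osc_decay (a b : ℝ) (ha : 0 < a) (hb : 0 < b) (x y : ℝ → ℝ)
    (hx : ∀ t : ℝ, 0 ≤ t → HasDerivAt x (y t) t)
    (hy : ∀ t : ℝ, 0 ≤ t → HasDerivAt y (-a * y t - b * x t) t) :
    ∃ M ω : ℝ, 0 < M ∧ 0 < ω ∧ ∀ t : ℝ, 0 ≤ t → |x t| ≤ M * Real.exp (-ω * t) := by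
  obtain ⟨e, he, hea, heb⟩ : ∃ e : ℝ, 0 < e ∧ 3 * e ≤ a ∧ e * a ≤ b := by
    refine ⟨min (a / 3) (b / a), by positivity, ?_, ?_⟩
    · have := min_le_left (a / 3) (b / a)
      linarith
    · exact (le_div_iff₀ ha).1 (min_le_right (a / 3) (b / a))
  let V : ℝ → ℝ := fun t => b * x t ^ 2 + y t ^ 2 + 2 * e * (x t * y t)
  have hVlow : ∀ t, b / 2 * x t ^ 2 ≤ V t := by
    intro t
    have h1 : e ^ 2 ≤ b / 2 := by nlinarith
    have h2 := mul_le_mul_of_nonneg_right h1 (sq_nonneg (x t))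
    simp only [V]
    nlinarith [sq_nonneg (y t + e * x t)]
  have key : ∀ X Y : ℝ, 0 ≤ (2 * a - 3 * e) * Y ^ 2 + e * b * X ^ 2
      + 2 * e * (a - e) * (X * Y) := by
    intro X Y
    have h1 : a * Y ^ 2 ≤ (2 * a - 3 * e) * Y ^ 2 :=
      mul_le_mul_of_nonneg_right (by linarith) (sq_nonneg Y)
    have h2 : e * (a - e) ^ 2 ≤ a * b := by
      have : (a - e) ^ 2 ≤ a ^ 2 := by nlinarith
      nlinarith
    have h3 : 0 ≤ e * (a * b - e * (a - e) ^ 2) * X ^ 2 :=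
      mul_nonneg (mul_nonneg he.le (by linarith)) (sq_nonneg X)
    have h4 : 0 ≤ a * (a * Y ^ 2 + e * b * X ^ 2 + 2 * e * (a - e) * (X * Y)) := by
      nlinarith [sq_nonneg (a * Y + e * (a - e) * X)]
    have h5 := nonneg_of_mul_nonneg_right h4 ha
    linarith
  have hg : ∀ t : ℝ, 0 ≤ t → HasDerivAt (fun t => V t * Real.exp (e * t))
      (-((2 * a - 3 * e) * y t ^ 2 + e * b * x t ^ 2
      + 2 * e * (a - e) * (x t * y t)) * Real.exp (e * t)) t := by
    intro t ht
    have h1 := hx t ht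
    have h2 := hy t ht
    have hV := (((h1.pow 2).const_mul b).add (h2.pow 2)).add ((h1.mul h2).const_mul (2 * e))
    have hE := ((hasDerivAt_id t).const_mul e).exp
    refine (hV.mul hE).congr_deriv ?_
    simp
    ring
  have hanti : AntitoneOn (fun t => V t * Real.exp (e * t)) (Set.Ici 0) := by
    apply antitoneOn_of_deriv_nonpos (convex_Ici 0)
    · intro t ht
      exact (hg t ht).continuousAt.continuousWithinAt
    · intro t ht
      rw [interior_Ici] at ht
      exact (hg t (le_of_lt ht)).differentiableAt.differentiableWithinAt
    · intro t ht
      rw [interior_Ici] at ht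
      rw [(hg t (le_of_lt ht)).deriv]
      have := mul_nonneg (key (x t) (y t)) (Real.exp_pos (e * t)).le
      linarith
  have hV0 : 0 ≤ V 0 := le_trans (by positivity) (hVlow 0)
  refine ⟨Real.sqrt (2 * V 0 / b) + 1, e / 2, by positivity, by positivity, ?_⟩
  intro t ht
  have h1 : V t * Real.exp (e * t) ≤ V 0 := by
    have := hanti (Set.mem_Ici.2 le_rfl) (Set.mem_Ici.2 ht) ht
    simpa using this
  have hexp : Real.exp (e * t) = Real.exp (e / 2 * t) ^ 2 := by
    rw [← Real.exp_nat_mul]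
    congr 1
    push_cast
    ring
  have h2 : (x t * Real.exp (e / 2 * t)) ^ 2 ≤ 2 * V 0 / b := by
    rw [mul_pow, ← hexp, le_div_iff₀ hb]
    have := mul_le_mul_of_nonneg_right (hVlow t) (Real.exp_pos (e * t)).le
    linarith
  have h3 := Real.abs_le_sqrt h2
  rw [abs_mul, abs_of_pos (Real.exp_pos _)] at h3
  rw [neg_mul, Real.exp_neg, ← div_eq_mul_inv, le_div_iff₀ (Real.exp_pos _)]
  linarith

/-- Exponential stability of the infected population for the age-discretized
normalized SIR model (NODE) under the linearizing state feedback: if all the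
control gains `α₁ᵏ, α₂ᵏ` are positive (so that both roots of
`s² + α₂ᵏ s + α₁ᵏ` lie in the open left half-plane), then along any solution of
the closed-loop system the infected proportions converge exponentially to zero. -/
theorem stmt_9
    (n : ℕ) (hn : 1 ≤ n)
    (T γ β N α₁ α₂ : ℕ → ℝ)
    (hβ : ∀ k ∈ Finset.Icc 1 n, β k ≠ 0)
    (hα₁ : ∀ k ∈ Finset.Icc 1 n, 0 < α₁ k)
    (hα₂ : ∀ k ∈ Finset.Icc 1 n, 0 < α₂ k)
    (iv sv : ℝ → ℕ → ℝ)
    (hi0 : ∀ t : ℝ, iv t 0 = 0)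
    (f : ℝ → ℕ → ℝ)
    (hf0 : ∀ t : ℝ, f t 0 = 0)
    (hf : ∀ t : ℝ, ∀ k ∈ Finset.Icc 1 n,
      f t k = T k * iv t (k - 1) - (T k + γ k) * iv t k +
        β k * sv t k * ∑ j ∈ Finset.Icc 1 n, N j * iv t j)
    (hS : ∀ t : ℝ, 0 ≤ t → (∑ j ∈ Finset.Icc 1 n, N j * iv t j) ≠ 0)
    (hdi : ∀ t : ℝ, 0 ≤ t → ∀ k ∈ Finset.Icc 1 n,
      HasDerivAt (fun τ => iv τ k) (f t k) t)
    (hds : ∀ t : ℝ, 0 ≤ t → ∀ k ∈ Finset.Icc 1 n,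
      HasDerivAt (fun τ => sv τ k)
        ((1 / (β k * ∑ j ∈ Finset.Icc 1 n, N j * iv t j)) *
          (f t k * (T k + γ k - α₂ k) - α₁ k * iv t k - T k * f t (k - 1) -
            β k * sv t k * ∑ j ∈ Finset.Icc 1 n, N j * f t j)) t) :
    ∃ M ω : ℝ, 0 < M ∧ 0 < ω ∧
      ∀ k ∈ Finset.Icc 1 n, ∀ t : ℝ, 0 ≤ t →
        |iv t k| ≤ M * Real.exp (-ω * t) := by
  have hk : ∀ k ∈ Finset.Icc 1 n, ∃ M ω : ℝ, 0 < M ∧ 0 < ω ∧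
      ∀ t : ℝ, 0 ≤ t → |iv t k| ≤ M * Real.exp (-ω * t) := by
    intro k hk
    refine osc_decay (α₂ k) (α₁ k) (hα₂ k hk) (hα₁ k hk) (fun t => iv t k) (fun t => f t k)
      (fun t ht => hdi t ht k hk) ?_
    intro t ht
    have hprev : HasDerivAt (fun τ => iv τ (k - 1)) (f t (k - 1)) t := by
      by_cases h1 : k = 1
      · subst h1
        simp only [Nat.sub_self, hi0, hf0]
        exact hasDerivAt_const t (0 : ℝ)
      · apply hdi t ht
        rw [Finset.mem_Icc] at hk ⊢
        omega
    have hsum : HasDerivAt (fun τ => ∑ j ∈ Finset.Icc 1 n, N j * iv τ j)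
        (∑ j ∈ Finset.Icc 1 n, N j * f t j) t :=
      HasDerivAt.fun_sum fun j hj => (hdi t ht j hj).const_mul (N j)
    have hfe : (fun τ => f τ k) = fun τ => T k * iv τ (k - 1) - (T k + γ k) * iv τ k +
        β k * sv τ k * ∑ j ∈ Finset.Icc 1 n, N j * iv τ j := funext fun τ => hf τ k hk
    rw [hfe]
    refine (((hprev.const_mul (T k)).sub ((hdi t ht k hk).const_mul (T k + γ k))).add
      (((hds t ht k hk).const_mul (β k)).mul hsum)).congr_deriv ?_
    beta_reduce
    have hb := hβ k hk
    have hs := hS t ht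
    generalize (∑ j ∈ Finset.Icc 1 n, N j * iv t j) = S at hs ⊢
    field_simp
    ring
  choose! M ω hM hω hb using hk
  obtain ⟨k0, hk0, hmin⟩ := Finset.exists_min_image (Finset.Icc 1 n) ω
    ⟨1, Finset.mem_Icc.2 ⟨le_rfl, hn⟩⟩
  refine ⟨∑ k ∈ Finset.Icc 1 n, M k, ω k0,
    Finset.sum_pos hM ⟨k0, hk0⟩, hω k0 hk0, ?_⟩
  intro k hk t ht
  refine (hb k hk t ht).trans ?_
  apply mul_le_mul
  · exact Finset.single_le_sum (fun j hj => (hM j hj).le) hk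
  · apply Real.exp_le_exp.2
    have := mul_le_mul_of_nonneg_right (hmin k hk) ht
    linarith
  · positivity
  · exact Finset.sum_nonneg fun j hj => (hM j hj).le
end

section
/- Let n ≥ 1 and let Tₖ > 0, γₖ ≥ 0, βₖ ≥ 0, Nⱼ ≥ 0 be constants, and let θₖ : [0,∞) → ℝ be continuous with θₖ(t) ≥ 0 for all t ≥ 0 and k = 1,…,n. Let (s₁,…,sₙ,i₁,…,iₙ) be a solution on [0,T) of the system dsₖ/dt = Tₖ s_{k-1} - (Tₖ + θₖ(t) + βₖ Σ_{j=1}^n Nⱼ iⱼ) sₖ, diₖ/dt = Tₖ i_{k-1} - (Tₖ+γₖ) iₖ + βₖ sₖ Σ_{j=1}^n Nⱼ iⱼ, with the conventions s₀(t) = 1 and i₀(t) = 0. If the initial condition lies in B = { (i₁,…,iₙ,s₁,…,sₙ) : iₖ ≥ 0, sₖ ≥ 0 and sₖ + iₖ ≤ 1 for k = 1,…,n }, then the solution remains in B for all t ∈ [0,T). -/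
open Finset Set

lemma aux_nonneg_s10 (K : Finset ℕ) (b C : ℝ) (u f : ℕ → ℝ → ℝ)
    (hd : ∀ t ∈ Icc (0:ℝ) b, ∀ k ∈ K, HasDerivAt (u k) (f k t) t)
    (h0 : ∀ k ∈ K, 0 ≤ u k 0)
    (hf : ∀ t ∈ Icc (0:ℝ) b, ∀ k ∈ K, ∀ m : ℝ, 0 ≤ m → (∀ j ∈ K, -m ≤ u j t) →
      u k t = -m → -(C * m) ≤ f k t) :
    ∀ t ∈ Icc (0:ℝ) b, ∀ k ∈ K, 0 ≤ u k t := by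
  have key : ∀ ε > 0, ∀ t ∈ Icc (0:ℝ) b, ∀ k ∈ K, 0 < u k t + ε * Real.exp ((C+1) * t) := by
    intro ε hε
    by_contra! hcon
    obtain ⟨t1, ht1, k1, hk1, hle1⟩ := hcon
    have hcw : ∀ k ∈ K, ContinuousOn (fun t => u k t + ε * Real.exp ((C+1) * t)) (Icc 0 b) := by
      intro k hk
      apply ContinuousOn.add
      · exact fun t ht => (hd t ht k hk).continuousAt.continuousWithinAt
      · fun_prop
    let A : Set ℝ := ⋃ k ∈ K, (Icc 0 b ∩ (fun t => u k t + ε * Real.exp ((C+1) * t)) ⁻¹' (Set.Iic 0))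
    have hAc : IsClosed A := by
      apply Set.Finite.isClosed_biUnion K.finite_toSet
      intro k hk
      exact (hcw k hk).preimage_isClosed_of_isClosed isClosed_Icc isClosed_Iic
    have hAm : ∀ t, t ∈ A ↔ ∃ k ∈ K, t ∈ Icc 0 b ∧ u k t + ε * Real.exp ((C+1) * t) ≤ 0 := by
      intro t
      simp only [A, Set.mem_iUnion, Set.mem_inter_iff, Set.mem_preimage, Set.mem_Iic, exists_prop]
    have hAs : A ⊆ Icc 0 b := by
      intro t ht
      obtain ⟨k, _, h, _⟩ := (hAm t).1 ht
      exact h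
    have hAk : IsCompact A := isCompact_Icc.of_isClosed_subset hAc hAs
    obtain ⟨t0, ht0A, ht0min⟩ := hAk.exists_isLeast ⟨t1, (hAm t1).2 ⟨k1, hk1, ht1, hle1⟩⟩
    obtain ⟨k, hk, ht0, hle⟩ := (hAm t0).1 ht0A
    have hpos : 0 < t0 := by
      rcases ht0.1.eq_or_lt with h | h
      · subst h
        have := h0 k hk
        simp at hle
        linarith
      · exact h
    have hbefore : ∀ t, 0 ≤ t → t < t0 → ∀ j ∈ K, 0 < u j t + ε * Real.exp ((C+1) * t) := by
      intro t h1 h2 j hj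
      by_contra! h
      have := ht0min ((hAm t).2 ⟨j, hj, ⟨h1, h2.le.trans ht0.2⟩, h⟩)
      linarith
    have hdw : ∀ j ∈ K, HasDerivAt (fun t => u j t + ε * Real.exp ((C+1) * t))
        (f j t0 + ε * (Real.exp ((C+1) * t0) * ((C+1) * 1))) t0 := by
      intro j hj
      exact (hd t0 ht0 j hj).add ((((hasDerivAt_id t0).const_mul (C+1)).exp).const_mul ε)
    have hev : ∀ᶠ t in nhdsWithin t0 (Set.Iio t0), 0 ≤ t ∧ t < t0 := by
      filter_upwards [Ioo_mem_nhdsLT hpos] with t ht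
      exact ⟨ht.1.le, ht.2⟩
    have hge : ∀ j ∈ K, 0 ≤ u j t0 + ε * Real.exp ((C+1) * t0) := by
      intro j hj
      have hc := ((hdw j hj).continuousAt.tendsto).mono_left
        (nhdsWithin_le_nhds (s := Set.Iio t0))
      refine ge_of_tendsto hc ?_
      filter_upwards [hev] with t ht
      exact (hbefore t ht.1 ht.2 j hj).le
    have hm : 0 < ε * Real.exp ((C+1) * t0) := by positivity
    have heq : u k t0 = -(ε * Real.exp ((C+1) * t0)) := by linarith [hge k hk]
    have hfk := hf t0 ht0 k hk _ hm.le (fun j hj => by linarith [hge j hj]) heq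
    have hslope := (hasDerivAt_iff_tendsto_slope.1 (hdw k hk)).mono_left
      (nhdsWithin_mono (s := Set.Iio t0) t0 (fun x (hx : x < t0) => (ne_of_lt hx : x ≠ t0)))
    have hle0 := le_of_tendsto (b := 0) hslope (by
      filter_upwards [hev] with t ht
      rw [slope_def_field]
      apply div_nonpos_of_nonneg_of_nonpos
      · linarith [hbefore t ht.1 ht.2 k hk]
      · linarith [ht.2])
    nlinarith
  intro t ht k hk
  by_contra! h
  have hE := Real.exp_pos ((C+1) * t)
  have := key (-(u k t) / Real.exp ((C+1) * t)) (by apply div_pos <;> linarith) t ht k hk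
  rw [div_mul_cancel₀ _ hE.ne'] at this
  linarith

lemma aux_scalar (b : ℝ) (u a g : ℝ → ℝ) (ha : ContinuousOn a (Icc 0 b))
    (hg : ∀ t ∈ Icc (0:ℝ) b, 0 ≤ g t)
    (hd : ∀ t ∈ Icc (0:ℝ) b, HasDerivAt u (g t - a t * u t) t) (h0 : 0 ≤ u 0) :
    ∀ t ∈ Icc (0:ℝ) b, 0 ≤ u t := by
  obtain ⟨C, hC⟩ := isCompact_Icc.exists_bound_of_continuousOn ha
  intro t ht
  refine aux_nonneg_s10 {0} b C (fun _ => u) (fun _ t => g t - a t * u t)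
    (fun t ht _ _ => hd t ht) (fun _ _ => h0) ?_ t ht 0 (by simp)
  intro t ht k _ m hm _ h
  have h1 := hC t ht
  rw [Real.norm_eq_abs, abs_le] at h1
  have h2 := hg t ht
  simp only [h]
  nlinarith

/-- Positive invariance for the age-discretized normalized SIR model (NODE):
with positive transfer-plus-death rates `Tₖ`, nonnegative recovery rates,
transmission coefficients, class populations and vaccination rates `θₖ(t)`, any
solution starting in
`B = {(i,s) : iₖ ≥ 0, sₖ ≥ 0, sₖ + iₖ ≤ 1}` remains in `B` on `[0,T)`. -/
theorem stmt_10
    (n : ℕ) (hn : 1 ≤ n)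
    (Tr γ β N : ℕ → ℝ)
    (hT : ∀ k ∈ Finset.Icc 1 n, 0 < Tr k)
    (hγ : ∀ k ∈ Finset.Icc 1 n, 0 ≤ γ k)
    (hβ : ∀ k ∈ Finset.Icc 1 n, 0 ≤ β k)
    (hN : ∀ j ∈ Finset.Icc 1 n, 0 ≤ N j)
    (θ : ℝ → ℕ → ℝ)
    (hθc : ∀ k ∈ Finset.Icc 1 n, Continuous fun t => θ t k)
    (hθ : ∀ t : ℝ, 0 ≤ t → ∀ k ∈ Finset.Icc 1 n, 0 ≤ θ t k)
    (Tmax : ℝ) (hTmax : 0 < Tmax)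
    (sv iv : ℝ → ℕ → ℝ)
    (hs0 : ∀ t : ℝ, sv t 0 = 1)
    (hi0 : ∀ t : ℝ, iv t 0 = 0)
    (hds : ∀ t ∈ Ico (0:ℝ) Tmax, ∀ k ∈ Finset.Icc 1 n,
      HasDerivAt (fun τ => sv τ k)
        (Tr k * sv t (k - 1) -
          (Tr k + θ t k + β k * ∑ j ∈ Finset.Icc 1 n, N j * iv t j) * sv t k) t)
    (hdi : ∀ t ∈ Ico (0:ℝ) Tmax, ∀ k ∈ Finset.Icc 1 n,
      HasDerivAt (fun τ => iv τ k)
        (Tr k * iv t (k - 1) - (Tr k + γ k) * iv t k +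
          β k * sv t k * ∑ j ∈ Finset.Icc 1 n, N j * iv t j) t)
    (hinit : ∀ k ∈ Finset.Icc 1 n,
      0 ≤ iv 0 k ∧ 0 ≤ sv 0 k ∧ sv 0 k + iv 0 k ≤ 1) :
    ∀ t ∈ Ico (0:ℝ) Tmax, ∀ k ∈ Finset.Icc 1 n,
      0 ≤ iv t k ∧ 0 ≤ sv t k ∧ sv t k + iv t k ≤ 1 := by
  have main : ∀ b, b < Tmax → ∀ t ∈ Icc (0:ℝ) b, ∀ k ∈ Finset.Icc 1 n,
      0 ≤ iv t k ∧ 0 ≤ sv t k ∧ sv t k + iv t k ≤ 1 := by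
    intro b hb
    have hsub : ∀ t ∈ Icc (0:ℝ) b, t ∈ Ico (0:ℝ) Tmax := fun t ht => ⟨ht.1, ht.2.trans_lt hb⟩
    have hsc : ∀ k ∈ Finset.Icc 1 n, ContinuousOn (fun t => sv t k) (Icc 0 b) := fun k hk t ht =>
      (hds t (hsub t ht) k hk).continuousAt.continuousWithinAt
    have hic : ∀ k ∈ Finset.Icc 1 n, ContinuousOn (fun t => iv t k) (Icc 0 b) := fun k hk t ht =>
      (hdi t (hsub t ht) k hk).continuousAt.continuousWithinAt
    have hSc : ContinuousOn (fun t => ∑ j ∈ Finset.Icc 1 n, N j * iv t j) (Icc 0 b) :=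
      continuousOn_finsetSum _ fun j hj => continuousOn_const.mul (hic j hj)
    -- susceptibles are nonnegative
    have hs : ∀ k, k ≤ n → ∀ t ∈ Icc (0:ℝ) b, 0 ≤ sv t k := by
      intro k
      induction k with
      | zero => intro _ t _; rw [hs0]; norm_num
      | succ k ih =>
        intro hk
        have hk' : k + 1 ∈ Finset.Icc 1 n := by simp; omega
        refine aux_scalar b (fun t => sv t (k+1))
          (fun t => Tr (k+1) + θ t (k+1) + β (k+1) * ∑ j ∈ Finset.Icc 1 n, N j * iv t j)
          (fun t => Tr (k+1) * sv t k) ?_ ?_ ?_ (hinit _ hk').2.1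
        · exact (continuousOn_const.add (hθc _ hk').continuousOn).add (continuousOn_const.mul hSc)
        · exact fun t ht => mul_nonneg (hT _ hk').le (ih (by omega) t ht)
        · intro t ht
          exact hds t (hsub t ht) _ hk'
    -- infected are nonnegative
    have hi : ∀ t ∈ Icc (0:ℝ) b, ∀ k ∈ Finset.Icc 1 n, 0 ≤ iv t k := by
      have hNs : 0 ≤ ∑ j ∈ Finset.Icc 1 n, N j := Finset.sum_nonneg hN
      have hcc : ContinuousOn (fun t => ∑ k ∈ Finset.Icc 1 n,
          (Tr k + β k * sv t k * ∑ j ∈ Finset.Icc 1 n, N j)) (Icc 0 b) :=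
        continuousOn_finsetSum _ fun k hk => continuousOn_const.add
          ((continuousOn_const.mul (hsc k hk)).mul continuousOn_const)
      obtain ⟨C, hC⟩ := isCompact_Icc.exists_bound_of_continuousOn hcc
      refine aux_nonneg_s10 (Finset.Icc 1 n) b C (fun k t => iv t k) (fun k t =>
        Tr k * iv t (k - 1) - (Tr k + γ k) * iv t k +
          β k * sv t k * ∑ j ∈ Finset.Icc 1 n, N j * iv t j)
        (fun t ht k hk => hdi t (hsub t ht) k hk) (fun k hk => (hinit k hk).1) ?_
      intro t ht k hk m hm hall heq
      have hkn := Finset.mem_Icc.1 hk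
      have hsn : ∀ k ∈ Finset.Icc 1 n, 0 ≤ sv t k := fun k hk =>
        hs k (Finset.mem_Icc.1 hk).2 t ht
      have hbs : 0 ≤ β k * sv t k := mul_nonneg (hβ k hk) (hsn k hk)
      have hprev : -m ≤ iv t (k - 1) := by
        by_cases h1 : k = 1
        · subst h1; simp [hi0, hm]
        · exact hall _ (by simp; omega)
      have hsum : -m * ∑ j ∈ Finset.Icc 1 n, N j ≤ ∑ j ∈ Finset.Icc 1 n, N j * iv t j := by
        rw [Finset.mul_sum]
        refine Finset.sum_le_sum fun j hj => ?_
        nlinarith [hN j hj, hall j hj]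
      have hCk : Tr k + β k * sv t k * ∑ j ∈ Finset.Icc 1 n, N j ≤ C := by
        refine le_trans ?_ ((le_abs_self _).trans (hC t ht))
        refine Finset.single_le_sum
          (f := fun k => Tr k + β k * sv t k * ∑ j ∈ Finset.Icc 1 n, N j) ?_ hk
        intro k hk
        exact add_nonneg (hT k hk).le (mul_nonneg (mul_nonneg (hβ k hk) (hsn k hk)) hNs)
      have e1 := mul_le_mul_of_nonneg_left hprev (hT k hk).le
      have e2 := mul_le_mul_of_nonneg_left hsum hbs
      have e3 := mul_le_mul_of_nonneg_right hCk hm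
      have e4 : 0 ≤ (Tr k + γ k) * m := mul_nonneg (add_nonneg (hT k hk).le (hγ k hk)) hm
      simp only [heq]
      nlinarith
    -- total at most one
    have hv : ∀ k, k ≤ n → ∀ t ∈ Icc (0:ℝ) b, 0 ≤ 1 - sv t k - iv t k := by
      intro k
      induction k with
      | zero => intro _ t _; rw [hs0, hi0]; norm_num
      | succ k ih =>
        intro hk
        have hk' : k + 1 ∈ Finset.Icc 1 n := by simp; omega
        refine aux_scalar b (fun t => 1 - sv t (k+1) - iv t (k+1)) (fun _ => Tr (k+1))
          (fun t => Tr (k+1) * (1 - sv t k - iv t k) + γ (k+1) * iv t (k+1)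
            + θ t (k+1) * sv t (k+1)) continuousOn_const ?_ ?_ ?_
        · intro t ht
          have a1 := mul_nonneg (hT _ hk').le (ih (by omega) t ht)
          have a2 := mul_nonneg (hγ _ hk') (hi t ht _ hk')
          have a3 := mul_nonneg (hθ t ht.1 _ hk') (hs _ hk t ht)
          linarith
        · intro t ht
          have d1 := ((hds t (hsub t ht) _ hk').const_sub 1).sub (hdi t (hsub t ht) _ hk')
          refine d1.congr_deriv ?_
          simp only [Nat.add_sub_cancel]
          ring
        · have := (hinit _ hk').2.2
          linarith
    intro t ht k hk
    have hkn := (Finset.mem_Icc.1 hk).2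
    exact ⟨hi t ht k hk, hs k hkn t ht, by linarith [hv k hkn t ht]⟩
  intro t ht
  exact main t ht.2 t ⟨ht.1, le_rfl⟩
end

section
/- Let L > 0, K > 0, c₁ ≥ 1 and 0 ≤ c₂ < K(c₁-1). Let G, H, κ : [0,L] → ℝ be continuous functions satisfying G(a)κ(a) ≤ -Kc₁ and H(a)-κ(a) ≤ -(K+c₂) for all a ∈ [0,L]. For x ∈ L¹(0,L) and t ≥ 0 define (Ũ₁(t)x)(a) = x(a-t)E_{Gκ}(a-t,a) if t ≤ a and 0 otherwise, (Ũ₂(t)x)(a) = x(a-t)E_{H-κ}(a-t,a) if t ≤ a and 0 otherwise, and (Ũ₁₂(t)x)(a) = x(a-t)∫₀^t E_{H-κ}(a-t, a-t+s)·E_{Gκ}(a-t+s, a) ds if t ≤ a and 0 otherwise, where E_f(x,y) = exp(∫ₓʸ f(η)dη). Then there exists M ≥ 1 such that for all t ≥ 0 and all x₀₁, x₀₂ ∈ L¹(0,L): ∫₀^L |(Ũ₁(t)x₀₁)(a) + (Ũ₁₂(t)x₀₂)(a)| da + ∫₀^L |(Ũ₂(t)x₀₂)(a)| da ≤ M e^{-(c₂+K)t}(‖x₀₁‖_{L¹}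 + ‖x₀₂‖_{L¹}). -/
open MeasureTheory Set

lemma aux_exp (L m : ℝ) (p : ℝ → ℝ) (hp : ContinuousOn p (Icc 0 L))
    (hm : ∀ a ∈ Icc (0:ℝ) L, p a ≤ -m) (u v : ℝ) (hu : 0 ≤ u) (huv : u ≤ v) (hv : v ≤ L) :
    Real.exp (∫ η in u..v, p η) ≤ Real.exp (-m * (v - u)) := by
  apply Real.exp_le_exp.mpr
  have hsub : Icc u v ⊆ Icc 0 L := Icc_subset_Icc hu hv
  have h := intervalIntegral.integral_mono_on (μ := volume) (f := p) (g := fun _ => -m) huv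
    ((hp.mono hsub).intervalIntegrable_of_Icc huv) intervalIntegrable_const
    (fun x hx => hm x (hsub hx))
  rw [intervalIntegral.integral_const, smul_eq_mul] at h
  linarith

lemma aux_shift (L t C : ℝ) (hL : 0 < L) (hC : 0 ≤ C) (ht : 0 ≤ t) (F f : ℝ → ℝ)
    (hf : IntervalIntegrable f volume 0 L) (hf0 : ∀ a, 0 ≤ f a) (hF0 : ∀ a, 0 ≤ F a)
    (h1 : ∀ a, 0 < a → a ≤ L → t ≤ a → F a ≤ C * f (a - t))
    (h2 : ∀ a, a < t → F a = 0) :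
    (∫ a in (0:ℝ)..L, F a) ≤ C * ∫ a in (0:ℝ)..L, f a := by
  rw [← intervalIntegral.integral_const_mul]
  rw [intervalIntegral.integral_of_le hL.le, intervalIntegral.integral_of_le hL.le]
  set g : ℝ → ℝ := (Icc 0 L).indicator (fun a => C * f a) with hg
  have hgi : Integrable g volume := by
    rw [hg, integrable_indicator_iff measurableSet_Icc, integrableOn_Icc_iff_integrableOn_Ioc]
    exact ((intervalIntegrable_iff_integrableOn_Ioc_of_le hL.le).mp hf).const_mul C
  have hg0 : ∀ a, 0 ≤ g a := fun a =>
    indicator_nonneg (fun x _ => mul_nonneg hC (hf0 x)) a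
  have hgs : Integrable (fun a => g (a - t)) volume := hgi.comp_sub_right t
  calc (∫ a in Ioc 0 L, F a) ≤ ∫ a in Ioc 0 L, g (a - t) := by
        apply integral_mono_of_nonneg (Filter.Eventually.of_forall hF0) hgs.integrableOn
        filter_upwards [ae_restrict_mem measurableSet_Ioc] with a ha
        by_cases hta : t ≤ a
        · have hmem : a - t ∈ Icc 0 L := ⟨by linarith, by linarith [ha.2]⟩
          simp only [hg, indicator_of_mem hmem]
          exact h1 a ha.1 ha.2 hta
        · rw [h2 a (not_le.mp hta)]
          exact hg0 _
    _ ≤ ∫ a, g (a - t) :=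
        setIntegral_le_integral hgs (Filter.Eventually.of_forall fun a => hg0 _)
    _ = ∫ a, g a := integral_sub_right_eq_self g t
    _ = ∫ a in Ioc 0 L, C * f a := by
        rw [hg, integral_indicator measurableSet_Icc, integral_Icc_eq_integral_Ioc]

/-- Exponential stability estimate for the triangularized closed-loop semigroup
of the feedback-controlled age-dependent SIR PIDE model on
`L¹(0,L) × L¹(0,L)`: under the pointwise bounds `Gκ ≤ -Kc₁` and
`H - κ ≤ -(K+c₂)` with `0 ≤ c₂ < K(c₁-1)`, the semigroup decays like
`M e^{-(c₂+K)t}`. -/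
theorem stmt_13
    (L K c₁ c₂ : ℝ) (hL : 0 < L) (hK : 0 < K) (hc₁ : 1 ≤ c₁)
    (hc₂0 : 0 ≤ c₂) (hc₂ : c₂ < K * (c₁ - 1))
    (G H κ : ℝ → ℝ)
    (hG : ContinuousOn G (Icc 0 L)) (hH : ContinuousOn H (Icc 0 L))
    (hκ : ContinuousOn κ (Icc 0 L))
    (hGκ : ∀ a ∈ Icc (0:ℝ) L, G a * κ a ≤ -(K * c₁))
    (hHκ : ∀ a ∈ Icc (0:ℝ) L, H a - κ a ≤ -(K + c₂)) :
    ∃ M : ℝ, 1 ≤ M ∧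
      ∀ t : ℝ, 0 ≤ t → ∀ x₀₁ x₀₂ : ℝ → ℝ,
        IntervalIntegrable x₀₁ volume 0 L →
        IntervalIntegrable x₀₂ volume 0 L →
        (∫ a in (0:ℝ)..L,
          |(if t ≤ a then
              x₀₁ (a - t) * Real.exp (∫ η in (a - t)..a, G η * κ η)
            else 0) +
           (if t ≤ a then
              x₀₂ (a - t) *
                ∫ s in (0:ℝ)..t,
                  Real.exp (∫ η in (a - t)..(a - t + s), H η - κ η) *
                    Real.exp (∫ η in (a - t + s)..a, G η * κ η)
            else 0)|) +
        (∫ a in (0:ℝ)..L,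
          |(if t ≤ a then
              x₀₂ (a - t) * Real.exp (∫ η in (a - t)..a, H η - κ η)
            else 0)|) ≤
        M * Real.exp (-(c₂ + K) * t) *
          ((∫ a in (0:ℝ)..L, |x₀₁ a|) + ∫ a in (0:ℝ)..L, |x₀₂ a|) := by
  have hm : c₂ + K ≤ K * c₁ := by linarith
  have hA := aux_exp L (c₂ + K) (fun a => G a * κ a) (hG.mul hκ)
    (fun a ha => by have := hGκ a ha; linarith)
  have hB := aux_exp L (c₂ + K) (fun a => H a - κ a) (hH.sub hκ)
    (fun a ha => by have := hHκ a ha; linarith)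
  refine ⟨1 + L, by linarith, ?_⟩
  intro t ht x y hx hy
  set E := Real.exp (-(c₂ + K) * t) with hE
  have hE0 : 0 < E := Real.exp_pos _
  have hxa := hx.abs
  have hya := hy.abs
  have hX : 0 ≤ ∫ a in (0:ℝ)..L, |x a| :=
    intervalIntegral.integral_nonneg hL.le (fun a _ => abs_nonneg _)
  have hY : 0 ≤ ∫ a in (0:ℝ)..L, |y a| :=
    intervalIntegral.integral_nonneg hL.le (fun a _ => abs_nonneg _)
  have key1 := aux_shift L t E hL hE0.le ht (fun a =>
          |(if t ≤ a then
              x (a - t) * Real.exp (∫ η in (a - t)..a, G η * κ η)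
            else 0) +
           (if t ≤ a then
              y (a - t) *
                ∫ s in (0:ℝ)..t,
                  Real.exp (∫ η in (a - t)..(a - t + s), H η - κ η) *
                    Real.exp (∫ η in (a - t + s)..a, G η * κ η)
            else 0)|) (fun a => |x a| + L * |y a|) (hxa.add (hya.const_mul L))
      (fun a => by positivity) (fun a => abs_nonneg _)
      (by
        intro a ha haL hta
        simp only [if_pos hta]
        have e1 : Real.exp (∫ η in (a - t)..a, G η * κ η) ≤ E := by
          have := hA (a - t) a (by linarith) (by linarith) haL
          rwa [sub_sub_cancel] at this
        have e2 : ‖∫ s in (0:ℝ)..t,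
                  Real.exp (∫ η in (a - t)..(a - t + s), H η - κ η) *
                    Real.exp (∫ η in (a - t + s)..a, G η * κ η)‖ ≤ E * |t - 0| := by
          apply intervalIntegral.norm_integral_le_of_norm_le_const
          intro s hs
          rw [uIoc_of_le ht] at hs
          have b1 := hB (a - t) (a - t + s) (by linarith) (by linarith [hs.1]) (by linarith [hs.2])
          have b2 := hA (a - t + s) a (by linarith [hs.1]) (by linarith [hs.2]) haL
          rw [Real.norm_of_nonneg (by positivity)]
          refine (mul_le_mul b1 b2 (by positivity) (by positivity)).trans ?_
          rw [← Real.exp_add, hE]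
          apply le_of_eq
          congr 1
          ring
        rw [sub_zero, abs_of_nonneg ht, Real.norm_eq_abs] at e2
        have e3 := e2.trans (mul_le_mul_of_nonneg_left (hta.trans haL) hE0.le)
        refine (abs_add_le _ _).trans ?_
        rw [abs_mul, abs_mul, abs_of_pos (Real.exp_pos _)]
        have f1 := mul_le_mul_of_nonneg_left e1 (abs_nonneg (x (a - t)))
        have f2 := mul_le_mul_of_nonneg_left e3 (abs_nonneg (y (a - t)))
        linarith)
      (by
        intro a ha
        simp [not_le.mpr ha])
  have key2 := aux_shift L t E hL hE0.le ht (fun a =>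
          |(if t ≤ a then
              y (a - t) * Real.exp (∫ η in (a - t)..a, H η - κ η)
            else 0)|) (fun a => |y a|) hya
      (fun a => abs_nonneg _) (fun a => abs_nonneg _)
      (by
        intro a ha haL hta
        simp only [if_pos hta]
        have e1 : Real.exp (∫ η in (a - t)..a, H η - κ η) ≤ E := by
          have := hB (a - t) a (by linarith) (by linarith) haL
          rwa [sub_sub_cancel] at this
        rw [abs_mul, abs_of_pos (Real.exp_pos _)]
        have f1 := mul_le_mul_of_nonneg_left e1 (abs_nonneg (y (a - t)))
        linarith)
      (by
        intro a ha
        simp [not_le.mpr ha])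
  rw [intervalIntegral.integral_add hxa (hya.const_mul L),
    intervalIntegral.integral_const_mul] at key1
  refine (add_le_add key1 key2).trans ?_
  have := mul_nonneg (mul_nonneg hL.le hE0.le) hX
  linarith
end

section
/- Let α > 0, L > 0, let β, γ, μ be continuous on [0,L], let Θ(t,a) be continuous and B ∈ ℝ. Let P : [0,∞)×[0,L] → ℝ be continuously differentiable with P > 0 and ∂ₜP + α∂ₐP = -μ(a)P, and let S, I, R : [0,∞)×[0,L] → ℝ be continuously differentiable solutions of (∂ₜ+α∂ₐ)S = -(Θ+μ(a))S - β(a)S∫₀^L I(t,b)db, (∂ₜ+α∂ₐ)I = -(μ(a)+γ(a))I + β(a)S∫₀^L I(t,b)db, (∂ₜ+α∂ₐ)R = ΘS + γ(a)I - μ(a)R. Define s = S/P, i = I/P and r = R/P. Then (s,i,r) satisfies the normalized system (∂ₜ+α∂ₐ)s = -Θs - β(a)s∫₀^L i(t,b)P(t,b)db, (∂ₜ+α∂ₐ)i = -γ(a)i + β(a)s∫₀^L i(t,b)P(t,b)db, and (∂ₜ+α∂ₐ)r = Θs + γ(a)i. -/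
open MeasureTheory Set

/-- Equivalence between the age-dependent SIR PIDE model in densities
`(S, I, R)` (with total population density `P` solving the transport-death
equation) and its normalized version: the proportions `s = S/P`, `i = I/P`,
`r = R/P` satisfy the normalized system (NPIDE). -/
theorem stmt_17
    (α L : ℝ) (hα : 0 < α) (hL : 0 < L)
    (β γ μ : ℝ → ℝ)
    (hβc : ContinuousOn β (Icc 0 L)) (hγc : ContinuousOn γ (Icc 0 L))
    (hμc : ContinuousOn μ (Icc 0 L))
    (Θ : ℝ → ℝ → ℝ) (hΘc : Continuous fun p : ℝ × ℝ => Θ p.1 p.2)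
    (B : ℝ)
    (P S I R Pt Pa St Sa It Ia Rt Ra : ℝ → ℝ → ℝ)
    (hPpos : ∀ t : ℝ, 0 ≤ t → ∀ a ∈ Icc (0:ℝ) L, 0 < P t a)
    (hPt : ∀ t : ℝ, 0 ≤ t → ∀ a ∈ Icc (0:ℝ) L,
      HasDerivAt (fun τ => P τ a) (Pt t a) t)
    (hPa : ∀ t : ℝ, 0 ≤ t → ∀ a ∈ Icc (0:ℝ) L,
      HasDerivAt (fun x => P t x) (Pa t a) a)
    (hPeq : ∀ t : ℝ, 0 ≤ t → ∀ a ∈ Icc (0:ℝ) L,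
      Pt t a + α * Pa t a = -μ a * P t a)
    (hSt : ∀ t : ℝ, 0 ≤ t → ∀ a ∈ Icc (0:ℝ) L,
      HasDerivAt (fun τ => S τ a) (St t a) t)
    (hSa : ∀ t : ℝ, 0 ≤ t → ∀ a ∈ Icc (0:ℝ) L,
      HasDerivAt (fun x => S t x) (Sa t a) a)
    (hIt : ∀ t : ℝ, 0 ≤ t → ∀ a ∈ Icc (0:ℝ) L,
      HasDerivAt (fun τ => I τ a) (It t a) t)
    (hIa : ∀ t : ℝ, 0 ≤ t → ∀ a ∈ Icc (0:ℝ) L,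
      HasDerivAt (fun x => I t x) (Ia t a) a)
    (hRt : ∀ t : ℝ, 0 ≤ t → ∀ a ∈ Icc (0:ℝ) L,
      HasDerivAt (fun τ => R τ a) (Rt t a) t)
    (hRa : ∀ t : ℝ, 0 ≤ t → ∀ a ∈ Icc (0:ℝ) L,
      HasDerivAt (fun x => R t x) (Ra t a) a)
    (heqS : ∀ t : ℝ, 0 ≤ t → ∀ a ∈ Icc (0:ℝ) L,
      St t a + α * Sa t a =
        -(Θ t a + μ a) * S t a - β a * S t a * ∫ b in (0:ℝ)..L, I t b)
    (heqI : ∀ t : ℝ, 0 ≤ t → ∀ a ∈ Icc (0:ℝ) L,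
      It t a + α * Ia t a =
        -(μ a + γ a) * I t a + β a * S t a * ∫ b in (0:ℝ)..L, I t b)
    (heqR : ∀ t : ℝ, 0 ≤ t → ∀ a ∈ Icc (0:ℝ) L,
      Rt t a + α * Ra t a = Θ t a * S t a + γ a * I t a - μ a * R t a) :
    ∀ t : ℝ, 0 ≤ t → ∀ a ∈ Icc (0:ℝ) L,
      ∃ st sa it ia rt ra : ℝ,
        HasDerivAt (fun τ => S τ a / P τ a) st t ∧
        HasDerivAt (fun x => S t x / P t x) sa a ∧
        HasDerivAt (fun τ => I τ a / P τ a) it t ∧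
        HasDerivAt (fun x => I t x / P t x) ia a ∧
        HasDerivAt (fun τ => R τ a / P τ a) rt t ∧
        HasDerivAt (fun x => R t x / P t x) ra a ∧
        st + α * sa =
          -Θ t a * (S t a / P t a) -
            β a * (S t a / P t a) * ∫ b in (0:ℝ)..L, (I t b / P t b) * P t b ∧
        it + α * ia =
          -γ a * (I t a / P t a) +
            β a * (S t a / P t a) * ∫ b in (0:ℝ)..L, (I t b / P t b) * P t b ∧
        rt + α * ra = Θ t a * (S t a / P t a) + γ a * (I t a / P t a) := by
  intro t ht a ha
  have hP : P t a ≠ 0 := (hPpos t ht a ha).ne'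
  have hint : (∫ b in (0:ℝ)..L, (I t b / P t b) * P t b) = ∫ b in (0:ℝ)..L, I t b := by
    apply intervalIntegral.integral_congr
    intro b hb
    rw [uIcc_of_le hL.le] at hb
    exact div_mul_cancel₀ _ (hPpos t ht b hb).ne'
  have key : ∀ ft fa f : ℝ,
      (ft * P t a - f * Pt t a) / P t a ^ 2 + α * ((fa * P t a - f * Pa t a) / P t a ^ 2)
        = (ft + α * fa + μ a * f) / P t a := by
    intro ft fa f
    have h := hPeq t ht a ha
    field_simp
    linear_combination (-f) * h
  refine ⟨_, _, _, _, _, _, (hSt t ht a ha).div (hPt t ht a ha) hP,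
    (hSa t ht a ha).div (hPa t ht a ha) hP, (hIt t ht a ha).div (hPt t ht a ha) hP,
    (hIa t ht a ha).div (hPa t ht a ha) hP, (hRt t ht a ha).div (hPt t ht a ha) hP,
    (hRa t ht a ha).div (hPa t ht a ha) hP, ?_, ?_, ?_⟩
  · rw [key, hint, heqS t ht a ha]
    ring
  · rw [key, hint, heqI t ht a ha]
    ring
  · rw [key, heqR t ht a ha]
    ring
end
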